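/- arXiv:2110.12709 — 2 statements merged into one kernel-verified Lean document; each statement's English description precedes it below -/
import Mathlib

section
/- Let (Ω, 𝒜, P) be a probability space and let τ : Ω → (ℕ → ℝ) be measurable such that for every ω the sequence n ↦ τ(ω)(n) is strictly decreasing, satisfies τ(ω)(0) < 0, and tends to -∞. Let 𝓖 be the σ-algebra on Ω generated by τ (the comap of τ). Then for every 𝓖-measurable X : Ω → ℝ and every ε > 0 there exist a natural number L ≥ 1, a real constant β₀, a bound B > 0, and measurable kernels h_n : ℝⁿ → ℝ for 1 ≤ n ≤ L, each vanishing outside [0, B]ⁿ, such that P(|X - Y| > ε) < ε, where Y(ω) = β₀ + ∑_{n=1}^{L} ∑_{(i_1,…,i_n)} h_n(-τ(ω)(i_1), …, -τ(ω)(i_n)), the inner sum ranging over all n-tuples (i_1,…,i_n) of indices i_k ∈ ℕ with τ(ω)(i_k) > -B (a finite sum for every ω). -/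
open MeasureTheory Filter

/-- The filtration on `ℕ → ℝ` generated by the first `n` coordinates. -/
def initialFiltration : Filtration ℕ (inferInstance : MeasurableSpace (ℕ → ℝ)) where
  seq n := MeasurableSpace.comap (fun (x : ℕ → ℝ) (i : Fin n) => x i) inferInstance
  mono' m n hmn := by
    refine Measurable.comap_le ?_
    have hproj : Measurable fun (y : Fin n → ℝ) (i : Fin m) => y (Fin.castLE hmn i) := by fun_prop
    exact hproj.comp (comap_measurable (fun (x : ℕ → ℝ) (i : Fin n) => x i))
  le' n := Measurable.comap_le (by fun_prop)

theorem le_iSup_initialFiltration :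
    (inferInstance : MeasurableSpace (ℕ → ℝ)) ≤ ⨆ n, initialFiltration n := by
  refine iSup_le fun k => ?_
  refine le_trans ?_ (le_iSup _ (k + 1))
  refine Measurable.comap_le ?_
  exact (measurable_pi_apply (Fin.last k)).comp
    (comap_measurable (fun (x : ℕ → ℝ) (i : Fin (k + 1)) => x i))

/-- A measurable function of a random sequence is approximated in probability by measurable
functions of finitely many coordinates. -/
theorem exists_measure_abs_sub_initial_lt (μ : Measure (ℕ → ℝ)) [IsProbabilityMeasure μ]
    {f : (ℕ → ℝ) → ℝ} (hf : Measurable f) {ε : ℝ} (hε : 0 < ε) {δ : ENNReal} (hδ : 0 < δ) :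
    ∃ (m : ℕ) (g : (Fin m → ℝ) → ℝ), Measurable g ∧
      μ {x | ε ≤ |f x - g (fun i => x i)|} < δ := by
  have htan : Measurable Real.tan := by
    have : Real.tan = fun x => Real.sin x / Real.cos x := funext Real.tan_eq_sin_div_cos
    rw [this]; fun_prop
  have hmeas : Measurable (fun x => Real.arctan (f x)) := Real.measurable_arctan.comp hf
  have hint : Integrable (fun x => Real.arctan (f x)) μ :=
    Integrable.of_bound hmeas.aestronglyMeasurable (Real.pi / 2)
      (ae_of_all _ fun x => abs_le.2
        ⟨(Real.neg_pi_div_two_lt_arctan _).le, (Real.arctan_lt_pi_div_two _).le⟩)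
  have hlim := hint.tendsto_ae_condExp (ℱ := initialFiltration)
    (hmeas.mono le_iSup_initialFiltration le_rfl).stronglyMeasurable
  let c : ℕ → (ℕ → ℝ) → ℝ := fun n x =>
    Real.tan ((μ[fun x => Real.arctan (f x) | initialFiltration n]) x)
  have hc : ∀ n, Measurable[initialFiltration n] (c n) := fun n =>
    htan.comp (stronglyMeasurable_condExp.measurable)
  have hc_lim : ∀ᵐ x ∂μ, Tendsto (fun n => c n x) atTop (nhds (f x)) := by
    filter_upwards [hlim] with x hx
    have hcont : ContinuousAt Real.tan (Real.arctan (f x)) :=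
      Real.continuousAt_tan.2 (Real.cos_arctan_pos _).ne'
    have := hcont.tendsto.comp hx
    rwa [Real.tan_arctan] at this
  have hTM := tendstoInMeasure_of_tendsto_ae
    (fun n => ((hc n).mono (initialFiltration.le n) le_rfl).aestronglyMeasurable) hc_lim
  obtain ⟨m, hm⟩ := ((hTM (ENNReal.ofReal ε) (ENNReal.ofReal_pos.2 hε)).eventually
    (gt_mem_nhds hδ)).exists
  obtain ⟨g, hg, hcg⟩ := (hc m).exists_eq_measurable_comp
  refine ⟨m, g, hg, lt_of_eq_of_lt ?_ hm⟩
  congr 1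
  ext x
  have : c m x = g (fun i => x i) := congrFun hcg x
  simp only [Set.mem_ofPred_eq, this, edist_dist, Real.dist_eq]
  rw [ENNReal.ofReal_le_ofReal_iff (abs_nonneg _), abs_sub_comm]

/-- Decreasing events with empty intersection have arbitrarily small probability. -/
theorem exists_measure_lt_of_antitone {Ω : Type*} [MeasurableSpace Ω] (P : Measure Ω)
    [IsFiniteMeasure P] {s : ℕ → Set Ω} (hs : ∀ n, MeasurableSet (s n)) (hanti : Antitone s)
    (hempty : ∀ ω, ∃ n, ω ∉ s n) {δ : ENNReal} (hδ : 0 < δ) : ∀ᶠ n in atTop, P (s n) < δ := by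
  have h := tendsto_measure_iInter_atTop (μ := P) (fun n => (hs n).nullMeasurableSet) hanti
    ⟨0, measure_ne_top _ _⟩
  have h_inter : ⋂ n, s n = ∅ := by
    ext ω
    simpa using hempty ω
  rw [h_inter, measure_empty] at h
  exact h.eventually (gt_mem_nhds hδ)

open scoped Classical in
/-- The kernels, supported on strictly increasing tuples in `[0, B]`, whose iterated sums over a
configuration of `n` points add up to `G n` of that configuration. -/
noncomputable def iteratedKernel (B : ℝ) (G : (n : ℕ) → (Fin n → ℝ) → ℝ) :
    (n : ℕ) → (Fin n → ℝ) → ℝ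
  | n, x =>
    if StrictMono x ∧ x ∈ Set.univ.pi (fun _ : Fin n => Set.Icc (0 : ℝ) B) then
      G n x - ∑ k : Fin n, ∑ ι : Fin k → Fin n, iteratedKernel B G k (fun j => x (ι j))
    else 0
termination_by n => n
decreasing_by exact k.2

theorem iteratedKernel_eq_zero {B : ℝ} {G : (n : ℕ) → (Fin n → ℝ) → ℝ} {n : ℕ} {x : Fin n → ℝ}
    (hx : ¬ (StrictMono x ∧ x ∈ Set.univ.pi (fun _ : Fin n => Set.Icc (0 : ℝ) B))) :
    iteratedKernel B G n x = 0 := by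
  rw [iteratedKernel, if_neg hx]

theorem measurable_iteratedKernel {B : ℝ} {G : (n : ℕ) → (Fin n → ℝ) → ℝ}
    (hG : ∀ n, Measurable (G n)) (n : ℕ) : Measurable (iteratedKernel B G n) := by
  induction n using Nat.strong_induction_on with
  | _ n ih =>
    have heq : iteratedKernel B G n = _ := funext fun x => iteratedKernel.eq_1 B G n x
    rw [heq]
    refine Measurable.ite ?_ ?_ measurable_const
    · refine MeasurableSet.inter (s₁ := {x : Fin n → ℝ | StrictMono x}) ?_
        (MeasurableSet.univ_pi fun _ => measurableSet_Icc)
      simp only [StrictMono, Set.ofPred_forall]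
      exact .iInter fun i => .iInter fun j => .iInter fun _ =>
        measurableSet_lt (measurable_pi_apply i) (measurable_pi_apply j)
    · refine (hG n).sub (Finset.measurable_sum _ fun k _ => Finset.measurable_sum _ fun ι _ => ?_)
      exact (ih k k.2).comp (measurable_pi_lambda _ fun j => measurable_pi_apply _)

/-- If exactly `N` points lie in the window, the iterated sum over `ℕ`-indexed tuples is a sum
over `Fin N`-indexed tuples. -/
theorem tsum_window_eq_sum {t : ℕ → ℝ} {B : ℝ} {N : ℕ} (hN : ∀ i, -B < t i ↔ i < N) {n : ℕ}
    (p : (Fin n → ℕ) → Prop) (hp : ∀ ι, p ι ↔ ∀ k, -B < t (ι k)) [DecidablePred p]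
    (h : (Fin n → ℝ) → ℝ) :
    (∑' ι : Fin n → ℕ, if p ι then h (fun k => -t (ι k)) else 0) =
      ∑ ι : Fin n → Fin N, h (fun k => -t (ι k)) := by
  have hinj : Function.Injective (fun (ι : Fin n → Fin N) (k : Fin n) => (ι k : ℕ)) :=
    fun a b hab => funext fun k => Fin.ext (congrFun hab k)
  rw [← hinj.tsum_eq, tsum_fintype]
  · refine Finset.sum_congr rfl fun ι _ => if_pos ?_
    exact (hp _).2 fun k => (hN _).2 (ι k).2
  · intro ι hι
    have hpι : p ι := by
      by_contra hcon
      exact hι (if_neg hcon)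
    exact ⟨fun k => ⟨ι k, (hN _).1 ((hp ι).1 hpι k)⟩, rfl⟩

theorem sum_iteratedKernel_eq {B : ℝ} {G : (n : ℕ) → (Fin n → ℝ) → ℝ} {N L : ℕ} (hNL : N ≤ L)
    {s : Fin N → ℝ} (hs : StrictMono s) (hsB : ∀ i, s i ∈ Set.Icc (0 : ℝ) B) :
    ∑ n ∈ Finset.range (L + 1), ∑ ι : Fin n → Fin N, iteratedKernel B G n (fun k => s (ι k)) =
      G N s := by
  have hmono : ∀ {n : ℕ} {ι : Fin n → Fin N},
      iteratedKernel B G n (fun k => s (ι k)) ≠ 0 → StrictMono ι := by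
    intro n ι hne a b hab
    by_contra hcon
    exact hne (iteratedKernel_eq_zero fun hx => hcon (hs.lt_iff_lt.1 (hx.1 hab)))
  have hlarge : ∀ n ∈ Finset.range (L + 1), n ∉ Finset.range (N + 1) →
      ∑ ι : Fin n → Fin N, iteratedKernel B G n (fun k => s (ι k)) = 0 := by
    intro n _ hn
    refine Finset.sum_eq_zero fun ι _ => ?_
    by_contra hne
    have := Fintype.card_le_of_injective ι (hmono hne).injective
    simp at this hn
    omega
  have hdiag : ∑ ι : Fin N → Fin N, iteratedKernel B G N (fun k => s (ι k)) =
      iteratedKernel B G N s := by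
    refine Finset.sum_eq_single id (fun ι _ hι => ?_) (by simp)
    by_contra hne
    refine hι (((hmono hne).range_inj strictMono_id).1 ?_)
    rw [((Finite.injective_iff_surjective).1 (hmono hne).injective).range_eq, Set.range_id]
  rw [← Finset.sum_subset (Finset.range_subset_range.2 (by omega)) hlarge, Finset.sum_range_succ,
    hdiag, iteratedKernel, if_pos ⟨hs, fun i _ => hsB i⟩,
    Finset.sum_range (fun n => ∑ ι : Fin n → Fin N, iteratedKernel B G n (fun k => s (ι k)))]
  ring

open scoped Classical in
/-- Univariate case of the paper's main theorem: for a simple, non-exploding point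
process on `(-∞, 0)` with event times `τ(ω)(0) > τ(ω)(1) > ⋯ → -∞` enumerated backwards,
any `σ(τ)`-measurable `X : Ω → ℝ` can be approximated in probability, within any `ε > 0`,
by `β₀` plus a finite sum of iterated-integral functionals: there are `L ≥ 1`, `β₀`,
`B > 0` and measurable kernels `h_n : ℝⁿ → ℝ` vanishing outside `[0, B]ⁿ` such that
`P(|X - Y| > ε) < ε`, where
`Y(ω) = β₀ + ∑_{n=1}^{L} ∑_{(i_1,…,i_n)} h_n(-τ(ω)(i_1), …, -τ(ω)(i_n))`, the inner sum
ranging over all tuples of indices with `τ(ω)(i_k) > -B` (a finite sum for every `ω`,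
written as a `tsum` with only finitely many nonzero terms). -/
theorem stmt_7 {Ω : Type*} [MeasurableSpace Ω] (P : Measure Ω) [IsProbabilityMeasure P]
    (τ : Ω → ℕ → ℝ) (hτ : Measurable τ)
    (hanti : ∀ ω, StrictAnti (τ ω)) (h0 : ∀ ω, τ ω 0 < 0)
    (htend : ∀ ω, Tendsto (τ ω) atTop atBot)
    (X : Ω → ℝ)
    (hX : Measurable[MeasurableSpace.comap τ inferInstance] X)
    (ε : ℝ) (hε : 0 < ε) :
    ∃ (L : ℕ) (β₀ B : ℝ) (h : (n : ℕ) → (Fin n → ℝ) → ℝ),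
      1 ≤ L ∧ 0 < B ∧
      (∀ n : ℕ, Measurable (h n)) ∧
      (∀ (n : ℕ) (x : Fin n → ℝ),
        x ∉ Set.univ.pi (fun _ : Fin n => Set.Icc (0 : ℝ) B) → h n x = 0) ∧
      P {ω | ε < |X ω - (β₀ + ∑ n ∈ Finset.Icc 1 L,
            ∑' ι : Fin n → ℕ,
              if ∀ k, -B < τ ω (ι k) then h n (fun k => -τ ω (ι k)) else 0)|}
        < ENNReal.ofReal ε := by
  have hδ : 0 < ENNReal.ofReal (ε / 3) := ENNReal.ofReal_pos.2 (by positivity)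
  obtain ⟨f, hf, rfl⟩ := hX.exists_eq_measurable_comp
  have : IsProbabilityMeasure (P.map τ) := Measure.isProbabilityMeasure_map hτ.aemeasurable
  obtain ⟨m, g, hg, hfg⟩ := exists_measure_abs_sub_initial_lt (P.map τ) hf hε hδ
  have hfg' : P {ω | ε ≤ |f (τ ω) - g (fun i => τ ω i)|} < ENNReal.ofReal (ε / 3) := by
    refine lt_of_eq_of_lt ?_ hfg
    rw [Measure.map_apply hτ (measurableSet_le measurable_const (by fun_prop))]
    rfl
  have hτi : ∀ i, Measurable fun ω => τ ω i := fun i => (measurable_pi_apply i).comp hτ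
  obtain ⟨b, hb⟩ := (exists_measure_lt_of_antitone P (s := fun b : ℕ => {ω | τ ω m ≤ -(b + 1 : ℝ)})
    (fun b => measurableSet_le (hτi m) measurable_const)
    (fun b c hbc ω (hω : τ ω m ≤ -(c + 1 : ℝ)) => by
      have : (b : ℝ) ≤ c := by exact_mod_cast hbc
      show τ ω m ≤ -(b + 1 : ℝ)
      linarith)
    (fun ω => by
      obtain ⟨n, hn⟩ := exists_nat_gt (-τ ω m)
      exact ⟨n, fun (h : τ ω m ≤ -(n + 1 : ℝ)) => by linarith⟩) hδ).exists
  set B : ℝ := b + 1 with hB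
  have hBpos : 0 < B := by positivity
  obtain ⟨L, hL, hL1⟩ := ((exists_measure_lt_of_antitone P (s := fun l : ℕ => {ω | -B < τ ω l})
    (fun l => measurableSet_lt measurable_const (hτi l))
    (fun l k hlk ω (hω : -B < τ ω k) => hω.trans_le ((hanti ω).antitone hlk))
    (fun ω => by
      obtain ⟨n, hn⟩ := ((htend ω).eventually (eventually_le_atBot (-B))).exists
      exact ⟨n, not_lt.2 hn⟩) hδ).and (eventually_ge_atTop 1)).exists
  let G : (n : ℕ) → (Fin n → ℝ) → ℝ := fun n s =>
    if hmn : m ≤ n then g (fun i => -s (Fin.castLE hmn i)) else 0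
  have hG : ∀ n, Measurable (G n) := by
    intro n
    by_cases hmn : m ≤ n
    · simp only [G, dif_pos hmn]
      fun_prop
    · simp only [G, dif_neg hmn]
      fun_prop
  refine ⟨L, iteratedKernel B G 0 Fin.elim0, B, iteratedKernel B G, hL1, hBpos,
    measurable_iteratedKernel hG, fun n x hx => iteratedKernel_eq_zero fun h => hx h.2, ?_⟩
  have hsub : ∀ ω, ω ∉ {ω | τ ω m ≤ -B} → ω ∉ {ω | -B < τ ω L} →
      iteratedKernel B G 0 Fin.elim0 + ∑ n ∈ Finset.Icc 1 L, ∑' ι : Fin n → ℕ,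
        (if ∀ k, -B < τ ω (ι k) then iteratedKernel B G n (fun k => -τ ω (ι k)) else 0) =
      g (fun i => τ ω i) := by
    intro ω hωm hωL
    simp only [Set.mem_ofPred_eq, not_le, not_lt] at hωm hωL
    have hex : ∃ i, τ ω i ≤ -B := ⟨L, hωL⟩
    set N := Nat.find hex
    have hN : ∀ i, -B < τ ω i ↔ i < N := fun i =>
      ⟨fun hi => by
        by_contra hcon
        exact absurd hi (not_lt.2
          (((hanti ω).antitone (not_lt.1 hcon)).trans (Nat.find_spec hex))),
        fun hi => not_le.1 (Nat.find_min hex hi)⟩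
    have hmN : m ≤ N := ((hN m).1 hωm).le
    have hsum := sum_iteratedKernel_eq (B := B) (G := G) (Nat.find_min' hex hωL)
      (s := fun i : Fin N => -τ ω i) (fun i j hij => neg_lt_neg (hanti ω hij))
      (fun i => ⟨by linarith [(hanti ω).antitone (Nat.zero_le i), h0 ω],
        by linarith [(hN i).2 i.2]⟩)
    have hGN : G N (fun i : Fin N => -τ ω i) = g (fun i => τ ω i) := by
      simp [G, hmN]
    rw [hGN, Finset.range_eq_Ico, Finset.sum_eq_sum_Ico_succ_bot (by omega)] at hsum
    rw [← hsum]
    congr 1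
    · rw [Fintype.sum_unique]
      exact congrArg _ (Subsingleton.elim _ _)
    · exact Finset.sum_congr rfl fun n _ =>
        tsum_window_eq_sum hN _ (fun _ => Iff.rfl) (iteratedKernel B G n)
  refine lt_of_le_of_lt (measure_mono (t := {ω | ε ≤ |f (τ ω) - g (fun i => τ ω i)|} ∪
    ({ω | τ ω m ≤ -B} ∪ {ω | -B < τ ω L})) fun ω hω => ?_) ?_
  · by_contra hcon
    simp only [Set.mem_union, not_or] at hcon
    obtain ⟨hω1, hω2, hω3⟩ := hcon
    rw [Set.mem_ofPred_eq, hsub ω hω2 hω3] at hω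
    exact hω1 hω.le
  · have hsplit : ENNReal.ofReal ε =
        ENNReal.ofReal (ε / 3) + (ENNReal.ofReal (ε / 3) + ENNReal.ofReal (ε / 3)) := by
      rw [← ENNReal.ofReal_add, ← ENNReal.ofReal_add] <;> first | positivity | (congr 1; ring)
    rw [hsplit]
    exact (measure_union_le _ _).trans_lt
      (ENNReal.add_lt_add hfg' ((measure_union_le _ _).trans_lt (ENNReal.add_lt_add hb hL)))
end

section
/- Let d ≥ 1, let (Ω, 𝒜, P) be a probability space, and for each mark j ∈ Fin d let τ^j : Ω → (ℕ → ℝ) be measurable such that for every ω each sequence n ↦ τ^j(ω)(n) is strictly decreasing, satisfies τ^j(ω)(0) < 0, and tends to -∞. Let 𝓖 be the σ-algebra on Ω generated jointly by (τ^j)_{j ∈ Fin d} (the supremum of the comaps). Then for every 𝓖-measurable X : Ω → ℝ and every ε > 0 there exist a natural number L ≥ 1, a real constant β₀, a bound B > 0, and for each 1 ≤ n ≤ L and each tuple of marks α = (j_1,…,j_n) ∈ (Fin d)ⁿ a measurable kernel h_n^α : ℝⁿ → ℝ vanishing outside [0, B]ⁿ, such that P(|X - Y| > ε) < ε, where Y(ω)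 = β₀ + ∑_{n=1}^{L} ∑_{α ∈ (Fin d)ⁿ} ∑_{(i_1,…,i_n)} h_n^α(-τ^{j_1}(ω)(i_1), …, -τ^{j_n}(ω)(i_n)), the innermost sum ranging over all tuples of indices i_k ∈ ℕ with τ^{j_k}(ω)(i_k) > -B (a finite sum for every ω). -/
open MeasureTheory Filter

/-- `X` lies in the closure of `A` for convergence in probability. -/
def ApproxInProb {Ω : Type*} [MeasurableSpace Ω] (P : Measure Ω)
    (A : Subalgebra ℝ (Ω → ℝ)) (X : Ω → ℝ) : Prop :=
  ∀ ε : ℝ, 0 < ε → ∃ Y ∈ A, P {ω | ε < |X ω - Y ω|} < ENNReal.ofReal ε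

namespace ApproxInProb

variable {Ω : Type*} [MeasurableSpace Ω] {P : Measure Ω} {A : Subalgebra ℝ (Ω → ℝ)}
  {X Z : Ω → ℝ}

theorem of_mem (hX : X ∈ A) : ApproxInProb P A X := by
  intro ε hε
  refine ⟨X, hX, ?_⟩
  simp [hε, hε.not_gt]

theorem of_forall_approx
    (h : ∀ ε : ℝ, 0 < ε → ∃ Z, ApproxInProb P A Z ∧ P {ω | ε < |X ω - Z ω|} < ENNReal.ofReal ε) :
    ApproxInProb P A X := by
  intro ε hε
  obtain ⟨Z, hZ, hXZ⟩ := h (ε / 2) (half_pos hε)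
  obtain ⟨Y, hY, hZY⟩ := hZ (ε / 2) (half_pos hε)
  refine ⟨Y, hY, ?_⟩
  calc P {ω | ε < |X ω - Y ω|}
      ≤ P ({ω | ε / 2 < |X ω - Z ω|} ∪ {ω | ε / 2 < |Z ω - Y ω|}) := by
        refine measure_mono fun ω hω => ?_
        by_contra hcon
        simp only [Set.mem_union, Set.mem_ofPred_eq, not_or, not_lt] at hcon hω
        linarith [abs_sub_le (X ω) (Z ω) (Y ω), hcon.1, hcon.2]
    _ ≤ P {ω | ε / 2 < |X ω - Z ω|} + P {ω | ε / 2 < |Z ω - Y ω|} := measure_union_le _ _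
    _ < ENNReal.ofReal (ε / 2) + ENNReal.ofReal (ε / 2) := ENNReal.add_lt_add hXZ hZY
    _ = ENNReal.ofReal ε := by
        rw [← ENNReal.ofReal_add (half_pos hε).le (half_pos hε).le, add_halves]

theorem add (hX : ApproxInProb P A X) (hZ : ApproxInProb P A Z) :
    ApproxInProb P A (X + Z) := by
  intro ε hε
  obtain ⟨Y, hY, hXY⟩ := hX (ε / 2) (half_pos hε)
  obtain ⟨Y', hY', hZY⟩ := hZ (ε / 2) (half_pos hε)
  refine ⟨Y + Y', A.add_mem hY hY', ?_⟩
  calc P {ω | ε < |(X + Z) ω - (Y + Y') ω|}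
      ≤ P ({ω | ε / 2 < |X ω - Y ω|} ∪ {ω | ε / 2 < |Z ω - Y' ω|}) := by
        refine measure_mono fun ω hω => ?_
        by_contra hcon
        simp only [Set.mem_union, Set.mem_ofPred_eq, not_or, not_lt, Pi.add_apply] at hcon hω
        have := abs_add_le (X ω - Y ω) (Z ω - Y' ω)
        rw [show X ω + Z ω - (Y ω + Y' ω) = X ω - Y ω + (Z ω - Y' ω) by ring] at hω
        linarith [hcon.1, hcon.2]
    _ ≤ P {ω | ε / 2 < |X ω - Y ω|} + P {ω | ε / 2 < |Z ω - Y' ω|} := measure_union_le _ _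
    _ < ENNReal.ofReal (ε / 2) + ENNReal.ofReal (ε / 2) := ENNReal.add_lt_add hXY hZY
    _ = ENNReal.ofReal ε := by
        rw [← ENNReal.ofReal_add (half_pos hε).le (half_pos hε).le, add_halves]

theorem const_mul (c : ℝ) (hX : ApproxInProb P A X) :
    ApproxInProb P A (fun ω => c * X ω) := by
  intro ε hε
  have hpos : 0 < |c| + 1 := by positivity
  obtain ⟨Y, hY, hXY⟩ := hX (ε / (|c| + 1)) (div_pos hε hpos)
  refine ⟨c • Y, A.smul_mem hY c, ?_⟩
  refine (measure_mono fun ω hω => ?_).trans_lt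
    (hXY.trans_le (ENNReal.ofReal_le_ofReal (div_le_self hε.le (by linarith [abs_nonneg c]))))
  simp only [Set.mem_ofPred_eq, Pi.smul_apply, smul_eq_mul, ← mul_sub, abs_mul] at hω ⊢
  rw [div_lt_iff₀ hpos]
  nlinarith [abs_nonneg (X ω - Y ω)]

/-- The product of two approximable functions bounded by `1` is approximable. -/
theorem mul_of_abs_le_one (hX : ApproxInProb P A X) (hZ : ApproxInProb P A Z)
    (hX1 : ∀ ω, |X ω| ≤ 1) (hZ1 : ∀ ω, |Z ω| ≤ 1) : ApproxInProb P A (X * Z) := by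
  intro ε hε
  set δ : ℝ := min (ε / 3) 1
  have hδ : 0 < δ := lt_min (by positivity) one_pos
  have hδ1 : δ ≤ 1 := min_le_right _ _
  have hδε : 3 * δ ≤ ε := by linarith [min_le_left (ε / 3) 1]
  obtain ⟨Y, hY, hXY⟩ := hX δ hδ
  obtain ⟨Y', hY', hZY⟩ := hZ δ hδ
  refine ⟨Y * Y', A.mul_mem hY hY', ?_⟩
  calc P {ω | ε < |(X * Z) ω - (Y * Y') ω|}
      ≤ P ({ω | δ < |X ω - Y ω|} ∪ {ω | δ < |Z ω - Y' ω|}) := by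
        refine measure_mono fun ω hω => ?_
        by_contra hcon
        simp only [Set.mem_union, Set.mem_ofPred_eq, not_or, not_lt, Pi.mul_apply] at hcon hω
        obtain ⟨h1, h2⟩ := hcon
        rw [show X ω * Z ω - Y ω * Y' ω
          = (X ω - Y ω) * Z ω + (X ω - (X ω - Y ω)) * (Z ω - Y' ω) by ring] at hω
        have h3 := abs_add_le ((X ω - Y ω) * Z ω) ((X ω - (X ω - Y ω)) * (Z ω - Y' ω))
        rw [abs_mul, abs_mul] at h3
        have h4 : |X ω - Y ω| * |Z ω| ≤ δ * 1 :=
          mul_le_mul h1 (hZ1 ω) (abs_nonneg _) hδ.le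
        have h5 : |X ω - (X ω - Y ω)| ≤ 1 + 1 :=
          (abs_sub _ _).trans (add_le_add (hX1 ω) (h1.trans hδ1))
        have h6 : |X ω - (X ω - Y ω)| * |Z ω - Y' ω| ≤ (1 + 1) * δ :=
          mul_le_mul h5 h2 (abs_nonneg _) (by norm_num)
        linarith
    _ ≤ P {ω | δ < |X ω - Y ω|} + P {ω | δ < |Z ω - Y' ω|} := measure_union_le _ _
    _ < ENNReal.ofReal δ + ENNReal.ofReal δ := ENNReal.add_lt_add hXY hZY
    _ = ENNReal.ofReal (δ + δ) := (ENNReal.ofReal_add hδ.le hδ.le).symm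
    _ ≤ ENNReal.ofReal ε := ENNReal.ofReal_le_ofReal (by linarith)

theorem indicator_compl {s : Set Ω} (hs : ApproxInProb P A (s.indicator 1)) :
    ApproxInProb P A (sᶜ.indicator 1) := by
  have h : (sᶜ.indicator 1 : Ω → ℝ) = 1 + fun ω => (-1) * s.indicator (1 : Ω → ℝ) ω := by
    ext ω
    by_cases hω : ω ∈ s <;> simp [hω]
  rw [h]
  exact (of_mem A.one_mem).add (hs.const_mul (-1))

theorem indicator_union {s t : Set Ω} (hs : ApproxInProb P A (s.indicator 1))
    (ht : ApproxInProb P A (t.indicator 1)) : ApproxInProb P A ((s ∪ t).indicator 1) := by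
  have hbd : ∀ (u : Set Ω) ω, |u.indicator (1 : Ω → ℝ) ω| ≤ 1 := fun u ω => by
    by_cases hω : ω ∈ u <;> simp [hω]
  have h := hs.indicator_compl.mul_of_abs_le_one ht.indicator_compl (hbd _) (hbd _)
  rw [← Set.inter_indicator_one, ← Set.compl_union] at h
  simpa only [compl_compl] using h.indicator_compl

theorem indicator_iUnion [IsFiniteMeasure P] {s : ℕ → Set Ω} (hm : ∀ i, MeasurableSet (s i))
    (hs : ∀ i, ApproxInProb P A ((s i).indicator 1)) :
    ApproxInProb P A ((⋃ i, s i).indicator 1) := by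
  have hacc : ∀ n, ApproxInProb P A ((Set.accumulate s n).indicator 1) := by
    intro n
    induction n with
    | zero => simpa using hs 0
    | succ n ih =>
      rw [Set.accumulate_succ]
      exact ih.indicator_union (hs _)
  have haccm : ∀ n, MeasurableSet (Set.accumulate s n) := fun n =>
    MeasurableSet.biUnion (Set.to_countable _) fun i _ => hm i
  refine of_forall_approx fun ε hε => ?_
  have hlim : Tendsto (fun n => P ((⋃ i, s i) \ Set.accumulate s n)) atTop (nhds 0) := by
    have := tendsto_measure_iInter_atTop (μ := P)
      (s := fun n => (⋃ i, s i) \ Set.accumulate s n)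
      (fun n => ((MeasurableSet.iUnion hm).diff (haccm n)).nullMeasurableSet)
      (fun m n hmn => Set.sdiff_subset_sdiff_right (Set.monotone_accumulate hmn))
      ⟨0, measure_ne_top _ _⟩
    rwa [← Set.sdiff_iUnion, Set.iUnion_accumulate, Set.sdiff_self, measure_empty] at this
  obtain ⟨n, hn⟩ := (hlim.eventually_lt_const (ENNReal.ofReal_pos.2 hε)).exists
  refine ⟨_, hacc n, (measure_mono fun ω hω => ?_).trans_lt hn⟩
  have hsub : Set.accumulate s n ⊆ ⋃ i, s i := Set.accumulate_subset_iUnion n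
  by_contra hcon
  have : (⋃ i, s i).indicator (1 : Ω → ℝ) ω = (Set.accumulate s n).indicator 1 ω := by
    by_cases h1 : ω ∈ Set.accumulate s n
    · rw [Set.indicator_of_mem h1, Set.indicator_of_mem (hsub h1)]
    · rw [Set.indicator_of_notMem h1, Set.indicator_of_notMem fun h2 => hcon ⟨h2, h1⟩]
  rw [Set.mem_ofPred_eq, this, sub_self, abs_zero] at hω
  exact hω.not_gt hε

end ApproxInProb

/-- The measurable sets whose indicator is approximable by elements of `A`. -/
@[reducible]
def approxMeasurableSpace {Ω : Type*} [MeasurableSpace Ω] (P : Measure Ω) [IsFiniteMeasure P]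
    (A : Subalgebra ℝ (Ω → ℝ)) : MeasurableSpace Ω where
  MeasurableSet' s := MeasurableSet s ∧ ApproxInProb P A (s.indicator 1)
  measurableSet_empty := ⟨MeasurableSet.empty, by
    rw [Set.indicator_empty']
    exact .of_mem A.zero_mem⟩
  measurableSet_compl _ hs := ⟨hs.1.compl, hs.2.indicator_compl⟩
  measurableSet_iUnion _ hs :=
    ⟨.iUnion fun i => (hs i).1, .indicator_iUnion (fun i => (hs i).1) fun i => (hs i).2⟩

theorem approxInProb_of_measurable {Ω : Type*} [MeasurableSpace Ω] {P : Measure Ω}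
    [IsFiniteMeasure P] {A : Subalgebra ℝ (Ω → ℝ)} {X : Ω → ℝ}
    (hX : Measurable[approxMeasurableSpace P A] X) : ApproxInProb P A X := by
  have hle : approxMeasurableSpace P A ≤ ‹MeasurableSpace Ω› := fun s hs => hs.1
  have hsm : StronglyMeasurable[approxMeasurableSpace P A] X := hX.stronglyMeasurable
  have hsimple : ∀ f : @SimpleFunc Ω (approxMeasurableSpace P A) ℝ, ApproxInProb P A f := by
    intro f
    refine @SimpleFunc.induction Ω ℝ (approxMeasurableSpace P A) _
      (fun f => ApproxInProb P A f) ?_ ?_ f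
    · intro c s hs
      convert hs.2.const_mul c using 1
      ext ω
      by_cases hω : ω ∈ s <;> simp [hω]
    · intro f g _ hf hg
      exact hf.add hg
  have htend : TendstoInMeasure P (fun n => ⇑(hsm.approx n)) atTop X :=
    tendstoInMeasure_of_tendsto_ae
      (fun n => ((hsm.approx n).stronglyMeasurable.mono hle).aestronglyMeasurable)
      (Eventually.of_forall hsm.tendsto_approx)
  rw [tendstoInMeasure_iff_dist] at htend
  refine .of_forall_approx fun ε hε => ?_
  obtain ⟨n, hn⟩ := ((htend ε hε).eventually_lt_const (ENNReal.ofReal_pos.2 hε)).exists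
  refine ⟨_, hsimple (hsm.approx n), (measure_mono fun ω hω => ?_).trans_lt hn⟩
  rw [Set.mem_ofPred_eq, dist_comm, Real.dist_eq]
  exact hω.le

/-- Superlevel sets of `ℕ`-valued measurable elements of `A` have approximable indicators. -/
theorem approxInProb_indicator_lt {Ω : Type*} [MeasurableSpace Ω] {P : Measure Ω}
    [IsFiniteMeasure P] {A : Subalgebra ℝ (Ω → ℝ)} {c : Ω → ℕ} (hc : Measurable c)
    (hcA : (fun ω => (c ω : ℝ)) ∈ A) (i : ℕ) :
    ApproxInProb P A ({ω | i < c ω}.indicator 1) := by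
  intro ε hε
  have hlim : Tendsto (fun n => P {ω | n < c ω}) atTop (nhds 0) := by
    have := tendsto_measure_iInter_atTop (μ := P) (s := fun n => {ω | n < c ω})
      (fun n => (measurableSet_lt measurable_const hc).nullMeasurableSet)
      (fun m n hmn ω hω => lt_of_le_of_lt hmn hω) ⟨0, measure_ne_top _ _⟩
    have hempty : ⋂ n, {ω | n < c ω} = ∅ :=
      Set.eq_empty_of_forall_notMem fun ω hω => lt_irrefl (c ω) (Set.mem_iInter.1 hω (c ω))
    rwa [hempty, measure_empty] at this
  obtain ⟨M, hM⟩ := (hlim.eventually_lt_const (ENNReal.ofReal_pos.2 hε)).exists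
  let p : Polynomial ℝ := Lagrange.interpolate (Finset.range (M + 1)) (fun m : ℕ => (m : ℝ))
    (fun m => if i < m then 1 else 0)
  have hp : ∀ m ≤ M, p.eval (m : ℝ) = if i < m then 1 else 0 := fun m hm =>
    Lagrange.eval_interpolate_at_node _ Nat.cast_injective.injOn
      (Finset.mem_range.2 (Nat.lt_succ_of_le hm))
  refine ⟨fun ω => p.eval (c ω : ℝ), ?_, (measure_mono fun ω hω => ?_).trans_lt hM⟩
  · convert Algebra.adjoin_le (Set.singleton_subset_iff.2 hcA)
      (Polynomial.aeval_mem_adjoin_singleton ℝ (p := p) _) using 1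
    ext ω
    rw [Polynomial.aeval_fn_apply, Polynomial.coe_aeval_eq_eval]
  · by_contra hcon
    simp only [Set.mem_ofPred_eq] at hω
    rw [hp _ (not_lt.1 hcon)] at hω
    by_cases h : i < c ω <;> simp [h] at hω <;> linarith

/-- `Y` is a finite sum of iterated-integral functionals of the points `τ` with measurable
kernels of bounded support. -/
def IsIteratedSum {Ω : Type*} {d : ℕ} (τ : Fin d → Ω → ℕ → ℝ) (Y : Ω → ℝ) : Prop :=
  ∃ (L : ℕ) (B : ℝ) (h : (n : ℕ) → (Fin n → Fin d) → (Fin n → ℝ) → ℝ),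
    (∀ n α, Measurable (h n α)) ∧ (∀ n α x, h n α x ≠ 0 → ∀ k, x k ∈ Set.Ico 0 B) ∧
    ∀ L' ≥ L, ∀ ω, Y ω = ∑ n ∈ Finset.range (L' + 1), ∑ α : Fin n → Fin d,
      ∑' ι : Fin n → ℕ, h n α (fun k => -τ (α k) ω (ι k))

namespace IsIteratedSum

variable {Ω : Type*} {d : ℕ} {τ : Fin d → Ω → ℕ → ℝ}

theorem summable_kernel (htend : ∀ j ω, Tendsto (τ j ω) atTop atBot) {n : ℕ}
    (α : Fin n → Fin d) (h : (Fin n → ℝ) → ℝ) {B : ℝ}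
    (hB : ∀ x, h x ≠ 0 → ∀ k, x k ∈ Set.Ico 0 B) (ω : Ω) :
    Summable fun ι : Fin n → ℕ => h (fun k => -τ (α k) ω (ι k)) := by
  have hfin : ∀ j, {i | -B < τ j ω i}.Finite := fun j => by
    have := (htend j ω).eventually_le_atBot (-B)
    rw [← Nat.cofinite_eq_atTop] at this
    simpa [Filter.Eventually, Filter.mem_cofinite, Set.compl_ofPred] using this
  refine summable_of_hasFiniteSupport ?_
  refine (Set.Finite.pi' fun k => hfin (α k)).subset fun ι hι k => ?_
  have := (hB _ hι k).2
  simp only [Set.mem_ofPred_eq]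
  linarith

theorem zero : IsIteratedSum τ 0 :=
  ⟨0, 0, fun _ _ _ => 0, fun _ _ => measurable_const, fun _ _ _ h => absurd rfl h, by simp⟩

theorem add (htend : ∀ j ω, Tendsto (τ j ω) atTop atBot) {Y Z : Ω → ℝ}
    (hY : IsIteratedSum τ Y) (hZ : IsIteratedSum τ Z) : IsIteratedSum τ (Y + Z) := by
  obtain ⟨L, B, h, hm, hs, he⟩ := hY
  obtain ⟨L', B', h', hm', hs', he'⟩ := hZ
  refine ⟨max L L', max B B', fun n α x => h n α x + h' n α x,
    fun n α => (hm n α).add (hm' n α), fun n α x hx k => ?_, fun K hK ω => ?_⟩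
  · by_cases h0 : h n α x = 0
    · have h1 : h' n α x ≠ 0 := by simpa [h0] using hx
      exact Set.Ico_subset_Ico_right (le_max_right _ _) (hs' n α x h1 k)
    · exact Set.Ico_subset_Ico_right (le_max_left _ _) (hs n α x h0 k)
  · rw [Pi.add_apply, he K (le_of_max_le_left hK), he' K (le_of_max_le_right hK),
      ← Finset.sum_add_distrib]
    refine Finset.sum_congr rfl fun n _ => ?_
    rw [← Finset.sum_add_distrib]
    refine Finset.sum_congr rfl fun α _ => ?_
    exact ((summable_kernel htend α _ (hs n α) ω).tsum_add
      (summable_kernel htend α _ (hs' n α) ω)).symm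

theorem smul (c : ℝ) {Y : Ω → ℝ} (hY : IsIteratedSum τ Y) : IsIteratedSum τ (c • Y) := by
  obtain ⟨L, B, h, hm, hs, he⟩ := hY
  refine ⟨L, B, fun n α x => c * h n α x, fun n α => (hm n α).const_mul c,
    fun n α x hx => hs n α x (right_ne_zero_of_mul hx), fun K hK ω => ?_⟩
  simp only [Pi.smul_apply, smul_eq_mul, he K hK, Finset.mul_sum, tsum_mul_left]

theorem of_kernel {n : ℕ} (α : Fin n → Fin d) {g : (Fin n → ℝ) → ℝ} (hg : Measurable g) {B : ℝ}
    (hB : ∀ x, g x ≠ 0 → ∀ k, x k ∈ Set.Ico 0 B) :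
    IsIteratedSum τ fun ω => ∑' ι : Fin n → ℕ, g (fun k => -τ (α k) ω (ι k)) := by
  classical
  have hcases : ∀ m β, (Pi.single n (Pi.single α g) :
      (n : ℕ) → (Fin n → Fin d) → (Fin n → ℝ) → ℝ) m β = 0 ∨ ∃ e : m = n, e ▸ β = α := by
    intro m β
    by_cases e : m = n
    · subst e
      by_cases hβ : β = α
      · exact .inr ⟨rfl, hβ⟩
      · left; simp [hβ]
    · left; simp [e]
  refine ⟨n, B, Pi.single n (Pi.single α g), fun m β => ?_, fun m β x hx => ?_,
    fun K hK ω => ?_⟩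
  · rcases hcases m β with h | ⟨rfl, rfl⟩
    · rw [h]; exact measurable_const
    · simpa using hg
  · rcases hcases m β with h | ⟨rfl, rfl⟩
    · simp [h] at hx
    · exact hB x (by simpa using hx)
  · rw [Finset.sum_eq_single n, Finset.sum_eq_single α]
    · simp
    · intro β _ hβ; simp [hβ]
    · simp
    · intro m _ hm; simp [hm]
    · intro h; exact absurd (Finset.mem_range.2 (Nat.lt_succ_of_le hK)) h

/-- A product of counting variables is an iterated sum. -/
theorem prod_count (h0 : ∀ j ω i, τ j ω i < 0) {c : Fin d → ℝ → Ω → ℕ}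
    (hc : ∀ j a ω i, a < τ j ω i ↔ i < c j a ω) {n : ℕ} (α : Fin n → Fin d) (a : Fin n → ℝ) :
    IsIteratedSum τ fun ω => ∏ k, (c (α k) (a k) ω : ℝ) := by
  classical
  obtain ⟨B, hB⟩ : ∃ B, ∀ k, -a k ≤ B := by
    obtain ⟨B, hB⟩ := (Set.finite_range fun k => -a k).bddAbove
    exact ⟨B, fun k => hB ⟨k, rfl⟩⟩
  set S : Set (Fin n → ℝ) := Set.univ.pi fun k => Set.Ico 0 (-a k)
  have hS : MeasurableSet S := MeasurableSet.univ_pi fun k => measurableSet_Ico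
  convert of_kernel (τ := τ) α (g := S.indicator 1) (measurable_one.indicator hS) (B := B) ?_
    using 2 with ω
  · have hmem : ∀ ι : Fin n → ℕ, (fun k => -τ (α k) ω (ι k)) ∈ S ↔
        ι ∈ Fintype.piFinset fun k => Finset.range (c (α k) (a k) ω) := by
      intro ι
      simp only [S, Set.mem_univ_pi, Set.mem_Ico, Fintype.mem_piFinset, Finset.mem_range, ← hc,
        neg_lt_neg_iff, Left.nonneg_neg_iff, (h0 _ _ _).le, true_and]
    rw [tsum_eq_sum (s := Fintype.piFinset fun k => Finset.range (c (α k) (a k) ω)),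
      Finset.sum_congr rfl fun ι hι => Set.indicator_of_mem ((hmem ι).2 hι) _]
    · simp
    · intro ι hι
      exact Set.indicator_of_notMem (mt (hmem ι).1 hι) _
  · intro x hx k
    have hxS : x ∈ S := by
      by_contra h
      exact hx (Set.indicator_of_notMem h _)
    exact Set.Ico_subset_Ico_right (hB k) (hxS k (Set.mem_univ k))

theorem of_mem_adjoin (htend : ∀ j ω, Tendsto (τ j ω) atTop atBot)
    (h0 : ∀ j ω i, τ j ω i < 0) {c : Fin d → ℝ → Ω → ℕ}
    (hc : ∀ j a ω i, a < τ j ω i ↔ i < c j a ω) {Y : Ω → ℝ}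
    (hY : Y ∈ Algebra.adjoin ℝ
      (Set.range fun p : Fin d × ℝ => fun ω => (c p.1 p.2 ω : ℝ))) : IsIteratedSum τ Y := by
  rw [← Subalgebra.mem_toSubmodule, Algebra.adjoin_eq_span] at hY
  induction hY using Submodule.span_induction with
  | mem Y hY =>
    obtain ⟨l, hl, rfl⟩ := Submonoid.exists_list_of_mem_closure hY
    choose p hp using fun k : Fin l.length => hl (l.get k) (l.get_mem k)
    convert prod_count h0 hc (fun k => (p k).1) (fun k => (p k).2) using 1
    ext ω
    conv_lhs => rw [← List.ofFn_get l, List.prod_ofFn]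
    rw [Finset.prod_apply]
    exact Finset.prod_congr rfl fun k _ => (congrFun (hp k) ω).symm
  | zero => exact zero
  | add _ _ _ _ h1 h2 => exact h1.add htend h2
  | smul r _ _ h => exact h.smul r

end IsIteratedSum

open scoped Classical in
/-- The paper's main theorem (Theorem 1) in its full marked form: for a `d`-dimensional
simple, non-exploding marked point process with event times `τ^j(ω)(0) > τ^j(ω)(1) > ⋯ → -∞`
(enumerated backwards) for each mark `j ∈ Fin d`, any `X : Ω → ℝ` measurable with respect
to the σ-algebra `𝓖 = ⨆_j σ(τ^j)` can be approximated in probability, within any `ε > 0`,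
by `β₀` plus a finite sum of iterated-integral functionals: there are `L ≥ 1`, `β₀`,
`B > 0` and, for each `n` and each tuple of marks `α ∈ (Fin d)ⁿ`, a measurable kernel
`h_n^α : ℝⁿ → ℝ` vanishing outside `[0, B]ⁿ`, such that `P(|X - Y| > ε) < ε`, where
`Y(ω) = β₀ + ∑_{n=1}^{L} ∑_{α} ∑_{(i_1,…,i_n)} h_n^α(-τ^{α 1}(ω)(i_1), …, -τ^{α n}(ω)(i_n))`,
the innermost sum ranging over all tuples of indices with `τ^{α k}(ω)(i_k) > -B`
(a finite sum for every `ω`, written as a `tsum` with only finitely many nonzero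
terms). -/
theorem stmt_8 {Ω : Type*} [MeasurableSpace Ω] (P : Measure Ω) [IsProbabilityMeasure P]
    (d : ℕ) (hd : 1 ≤ d)
    (τ : Fin d → Ω → ℕ → ℝ) (hτ : ∀ j, Measurable (τ j))
    (hanti : ∀ j ω, StrictAnti (τ j ω)) (h0 : ∀ j ω, τ j ω 0 < 0)
    (htend : ∀ j ω, Tendsto (τ j ω) atTop atBot)
    (X : Ω → ℝ)
    (hX : Measurable[⨆ j : Fin d, MeasurableSpace.comap (τ j) inferInstance] X)
    (ε : ℝ) (hε : 0 < ε) :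
    ∃ (L : ℕ) (β₀ B : ℝ) (h : (n : ℕ) → (Fin n → Fin d) → (Fin n → ℝ) → ℝ),
      1 ≤ L ∧ 0 < B ∧
      (∀ (n : ℕ) (α : Fin n → Fin d), Measurable (h n α)) ∧
      (∀ (n : ℕ) (α : Fin n → Fin d) (x : Fin n → ℝ),
        x ∉ Set.univ.pi (fun _ : Fin n => Set.Icc (0 : ℝ) B) → h n α x = 0) ∧
      P {ω | ε < |X ω - (β₀ + ∑ n ∈ Finset.Icc 1 L, ∑ α : Fin n → Fin d,
            ∑' ι : Fin n → ℕ,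
              if ∀ k, -B < τ (α k) ω (ι k) then h n α (fun k => -τ (α k) ω (ι k))
              else 0)|}
        < ENNReal.ofReal ε := by
  have hex : ∀ j (a : ℝ) ω, ∃ m : ℕ, ∀ i, a < τ j ω i ↔ i < m := by
    intro j a ω
    have hm : ∃ m, τ j ω m ≤ a := ((htend j ω).eventually_le_atBot a).exists
    refine ⟨Nat.find hm, fun i => ⟨fun hi => ?_, fun hi => not_le.1 (Nat.find_min hm hi)⟩⟩
    by_contra hcon
    exact hi.not_ge (((hanti j ω).antitone (not_lt.1 hcon)).trans (Nat.find_spec hm))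
  choose c hc using hex
  have hneg : ∀ j ω i, τ j ω i < 0 := fun j ω i =>
    ((hanti j ω).antitone (Nat.zero_le i)).trans_lt (h0 j ω)
  have hcm : ∀ j a, Measurable (c j a) := fun j a => measurable_of_Ioi fun i => by
    have : c j a ⁻¹' Set.Ioi i = {ω | a < τ j ω i} := by
      ext ω
      exact (hc j a ω i).symm
    rw [this]
    exact measurableSet_lt measurable_const ((measurable_pi_apply i).comp (hτ j))
  set A : Subalgebra ℝ (Ω → ℝ) := Algebra.adjoin ℝ
    (Set.range fun p : Fin d × ℝ => fun ω => (c p.1 p.2 ω : ℝ))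
  have hle : (⨆ j : Fin d, MeasurableSpace.comap (τ j) inferInstance)
      ≤ approxMeasurableSpace P A := by
    refine iSup_le fun j => Measurable.comap_le ?_
    refine @measurable_pi_lambda _ _ _ (approxMeasurableSpace P A) _ _ fun i => ?_
    refine @measurable_of_Ioi _ _ _ _ _ (approxMeasurableSpace P A) _ _ _ _ fun a => ?_
    have hpre : (fun ω => τ j ω i) ⁻¹' Set.Ioi a = {ω | i < c j a ω} := by
      ext ω
      exact hc j a ω i
    rw [hpre]
    exact ⟨measurableSet_lt measurable_const (hcm j a),
      approxInProb_indicator_lt (hcm j a)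
        (Algebra.subset_adjoin (Set.mem_range_self (j, a))) i⟩
  obtain ⟨Y, hYA, hY⟩ := approxInProb_of_measurable (hX.mono hle le_rfl) ε hε
  obtain ⟨L, B, h, hm, hs, he⟩ := IsIteratedSum.of_mem_adjoin htend hneg hc hYA
  refine ⟨max L 1, ∑ α : Fin 0 → Fin d, h 0 α Fin.elim0, max B 1, h, le_max_right _ _,
    lt_max_of_lt_right one_pos, hm, fun n α x hx => ?_, ?_⟩
  · by_contra hne
    exact hx fun k _ => ⟨(hs n α x hne k).1, (hs n α x hne k).2.le.trans (le_max_left _ _)⟩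
  · have hterm : ∀ ω n (α : Fin n → Fin d) (ι : Fin n → ℕ),
        (if ∀ k, -max B 1 < τ (α k) ω (ι k) then h n α (fun k => -τ (α k) ω (ι k)) else 0)
          = h n α (fun k => -τ (α k) ω (ι k)) := by
      intro ω n α ι
      refine ite_eq_left_iff.2 fun hk => ?_
      by_contra hne
      exact hk fun k => by
        linarith [(hs n α _ (Ne.symm hne) k).2, le_max_left B 1]
    have hconst : ∀ ω (α : Fin 0 → Fin d),
        ∑' ι : Fin 0 → ℕ, h 0 α (fun k => -τ (α k) ω (ι k)) = h 0 α Fin.elim0 := by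
      intro ω α
      rw [tsum_fintype, Fintype.sum_unique]
      congr 1
      exact Subsingleton.elim _ _
    simp only [hterm]
    convert hY using 7 with ω
    rw [he _ (le_max_left L 1) ω, Finset.range_eq_Ico, Finset.sum_eq_sum_Ico_succ_bot (by omega)]
    simp only [hconst]
    rfl
end
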